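/- Suppose the ESA hypothesis with tolerance ε ∈ (0,1) holds for each α_k, 1 ≤ k ≤ n. Let m ≥ 2 be an integer, Δx = x_R/m, and let real numbers E_j^k (0 ≤ j ≤ m, 0 ≤ k ≤ n) and r_j^k (1 ≤ j ≤ m−1, 1 ≤ k ≤ n) satisfy, for all 1 ≤ j ≤ m−1 and 1 ≤ k ≤ n, −E_{j+1}^k + (2 + s_k)·E_j^k − E_{j−1}^k = s_k·Σ_{l=1}^{k−1} b_l^k·E_j^l + s_k·b_0^k·E_j^0 + Δx²·r_j^k, together with E_j^0 = 0 for 1 ≤ j ≤ m−1 and E_0^k = E_m^k = 0 for 1 ≤ k ≤ n. Set c_r = max_{1≤k≤n} max_{1≤j≤m−1} |r_j^k| and c_γ = max_{1≤k≤n} Γ(1−α_k). Then for every 1 ≤ k ≤ n, max_{1≤j≤m−1} |E_j^k| ≤ c_r·c_γ·((1+2ε)^k/(1−ε))·T^{ᾱ}. -/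

import Mathlib

open Real MeasureTheory Finset

/-- Time step `Δt = T / n`. -/
noncomputable def dt (T : ℝ) (n : ℕ) : ℝ := T / n

/-- Time grid point `t_k = k Δt`. -/
noncomputable def tk (T : ℝ) (n k : ℕ) : ℝ := k * dt T n

/-- Quadrature exponent `λ_i = e^{i h}`. -/
noncomputable def lamESA (h : ℝ) (i : ℤ) : ℝ := Real.exp ((i : ℝ) * h)

/-- Quadrature weight `θ_{a,i} = h e^{a i h} / Γ(a)`. -/
noncomputable def thESA (a h : ℝ) (i : ℤ) : ℝ := h * Real.exp (a * (i : ℝ) * h) / Real.Gamma a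

/-- Piecewise-constant interpolation `Π₁u'` of the derivative:
`Π₁u'(τ) = (u(t_l) - u(t_{l-1}))/Δt` for `τ ∈ (t_{l-1}, t_l]`. -/
noncomputable def Pi1 (T : ℝ) (n : ℕ) (u : ℝ → ℝ) (τ : ℝ) : ℝ :=
  (u (tk T n ⌈τ / dt T n⌉₊) - u (tk T n (⌈τ / dt T n⌉₊ - 1))) / dt T n

/-- The ESA hypothesis with tolerance `ε`:
`|s^{-a} - Σ_{i=Nlo+1}^{Nhi} θ_{a,i} e^{-λ_i s}| ≤ ε s^{-a}` for all `s ∈ [Dt/T, 1]`. -/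
def ESAhyp (a Dt T ε h : ℝ) (Nlo Nhi : ℤ) : Prop :=
  ∀ s ∈ Set.Icc (Dt / T) 1,
    |s ^ (-a) - ∑ i ∈ Finset.Icc (Nlo + 1) Nhi, thESA a h i * Real.exp (-(lamESA h i) * s)|
      ≤ ε * s ^ (-a)

/-- `Ib k j = Σ_i θ_{a,i} ∫_{t_{j-1}}^{t_j} e^{-λ_i (t_k - τ)/T} dτ`. -/
noncomputable def Ib (T : ℝ) (n : ℕ) (a h : ℝ) (Nlo Nhi : ℤ) (k j : ℕ) : ℝ :=
  ∑ i ∈ Finset.Icc (Nlo + 1) Nhi,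
    thESA a h i * ∫ τ in (tk T n (j-1))..(tk T n j), Real.exp (-(lamESA h i) * (tk T n k - τ) / T)

/-- The coefficients `b_l^k` of the fast ESA scheme (with `a` the order at level `k`):
`b_0^1 = 1`; for `k ≥ 2`, `b_0^k = T^{-a} Δt^{a-1}(1-a) Ib k 1`,
`b_{k-1}^k = 1 - T^{-a} Δt^{a-1}(1-a) Ib k (k-1)`, and
`b_l^k = T^{-a} Δt^{a-1}(1-a) (Ib k (l+1) - Ib k l)` for `1 ≤ l ≤ k-2`. -/
noncomputable def bcoef (T : ℝ) (n : ℕ) (a h : ℝ) (Nlo Nhi : ℤ) (k l : ℕ) : ℝ :=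
  if k = 1 then 1
  else if l = 0 then T ^ (-a) * (dt T n) ^ (a - 1) * (1 - a) * Ib T n a h Nlo Nhi k 1
  else if l = k - 1 then
    1 - T ^ (-a) * (dt T n) ^ (a - 1) * (1 - a) * Ib T n a h Nlo Nhi k (k-1)
  else T ^ (-a) * (dt T n) ^ (a - 1) * (1 - a) *
    (Ib T n a h Nlo Nhi k (l+1) - Ib T n a h Nlo Nhi k l)

/-- `s_k = Δx² Δt^{-a} / Γ(2-a)` (with `a` the order at level `k`). -/
noncomputable def skcoef (T : ℝ) (n : ℕ) (a Dx : ℝ) : ℝ :=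
  Dx ^ 2 * (dt T n) ^ (-a) / Real.Gamma (2 - a)

lemma dt_pos {T : ℝ} (hT : 0 < T) {n : ℕ} (hn : 0 < n) : 0 < dt T n :=
  div_pos hT (Nat.cast_pos.2 hn)

lemma tk_succ (T : ℝ) (n k : ℕ) : tk T n (k + 1) = tk T n k + dt T n := by
  simp only [tk]; push_cast; ring

lemma tk_nonneg {T : ℝ} (hT : 0 ≤ T) (n k : ℕ) : 0 ≤ tk T n k :=
  mul_nonneg k.cast_nonneg (div_nonneg hT n.cast_nonneg)

lemma tk_mono {T : ℝ} (hT : 0 ≤ T) (n : ℕ) : Monotone (tk T n) := fun _ _ hab =>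
  mul_le_mul_of_nonneg_right (Nat.cast_le.2 hab) (div_nonneg hT n.cast_nonneg)

lemma tk_self (T : ℝ) {n : ℕ} (hn : 0 < n) : tk T n n = T := by
  have : (n : ℝ) ≠ 0 := by positivity
  simp only [tk, dt]; field_simp

lemma thESA_nonneg {a h : ℝ} (ha : 0 < a) (hh : 0 < h) (i : ℤ) : 0 ≤ thESA a h i :=
  div_nonneg (mul_nonneg hh.le (Real.exp_pos _).le) (Real.Gamma_pos_of_pos ha).le

/-- The history integrals increase towards the current time level. -/
lemma Ib_le_Ib_succ {T : ℝ} (hT : 0 < T) (n : ℕ) {a h : ℝ} (ha : 0 < a) (hh : 0 < h)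
    (Nlo Nhi : ℤ) (k l : ℕ) :
    Ib T n a h Nlo Nhi k (l + 1) ≤ Ib T n a h Nlo Nhi k (l + 2) := by
  have hd : 0 ≤ dt T n := div_nonneg hT.le n.cast_nonneg
  unfold Ib
  refine Finset.sum_le_sum fun i _ => mul_le_mul_of_nonneg_left ?_ (thESA_nonneg ha hh i)
  have hl : 0 < lamESA h i := Real.exp_pos _
  rw [show l + 2 - 1 = l + 1 from rfl, show l + 1 - 1 = l from rfl, tk_succ T n (l + 1)]
  nth_rewrite 2 [tk_succ T n l]
  rw [← intervalIntegral.integral_comp_add_right]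
  refine intervalIntegral.integral_mono_on (tk_mono hT.le n (Nat.le_succ l))
    (Continuous.intervalIntegrable (by fun_prop) _ _)
    (Continuous.intervalIntegrable (by fun_prop) _ _) fun τ _ => ?_
  refine Real.exp_le_exp.2 (div_le_div_of_nonneg_right ?_ hT.le)
  nlinarith

/-- A history integral is the integral of the whole exponential sum. -/
lemma Ib_eq_integral (T : ℝ) (n : ℕ) (a h : ℝ) (Nlo Nhi : ℤ) (k l : ℕ) :
    Ib T n a h Nlo Nhi k (l + 1) = ∫ τ in (tk T n l)..(tk T n (l + 1)),
      ∑ i ∈ Finset.Icc (Nlo + 1) Nhi,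
        thESA a h i * Real.exp (-(lamESA h i) * ((tk T n k - τ) / T)) := by
  rw [intervalIntegral.integral_finsetSum
    fun i _ => Continuous.intervalIntegrable (by fun_prop) _ _]
  simp only [intervalIntegral.integral_const_mul, Ib, mul_div_assoc, Nat.add_sub_cancel]

section ESAbounds

variable {T : ℝ} {n : ℕ} {a ε h : ℝ} {Nlo Nhi : ℤ}

lemma scaled_lag_mem_Icc (hT : 0 < T) (hn : 0 < n) {k l : ℕ} (hlk : l + 2 ≤ k) (hkn : k ≤ n)
    {τ : ℝ} (hτ : τ ∈ Set.Icc (tk T n l) (tk T n (l + 1))) :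
    (tk T n k - τ) / T ∈ Set.Icc (dt T n / T) 1 := by
  have h1 := tk_mono hT.le n hlk
  have h2 := tk_mono hT.le n hkn
  have h3 := tk_nonneg hT.le n l
  rw [tk_succ T n (l + 1)] at h1
  rw [tk_self T hn] at h2
  refine ⟨div_le_div_of_nonneg_right (by linarith [hτ.2]) hT.le, ?_⟩
  rw [div_le_one hT]
  linarith [hτ.1]

lemma ESAhyp.le_Ib (hesa : ESAhyp a (dt T n) T ε h Nlo Nhi) (hT : 0 < T) (hn : 0 < n)
    (ha : 0 < a) (hε : ε < 1) {k l : ℕ} (hlk : l + 2 ≤ k) (hkn : k ≤ n) :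
    (1 - ε) * dt T n ≤ Ib T n a h Nlo Nhi k (l + 1) := by
  have hle := tk_mono hT.le n (Nat.le_succ l)
  rw [Ib_eq_integral]
  calc (1 - ε) * dt T n = ∫ _ in (tk T n l)..(tk T n (l + 1)), (1 - ε) := by
        rw [intervalIntegral.integral_const, smul_eq_mul, tk_succ]; ring
    _ ≤ _ := by
      refine intervalIntegral.integral_mono_on hle
        (Continuous.intervalIntegrable (by fun_prop) _ _)
        (Continuous.intervalIntegrable (by fun_prop) _ _) fun τ hτ => ?_
      have hs := scaled_lag_mem_Icc hT hn hlk hkn hτ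
      have hspos := (div_pos (dt_pos hT hn) hT).trans_le hs.1
      have h1 := (abs_le.1 (hesa _ hs)).2
      have h2 := Real.one_le_rpow_of_pos_of_le_one_of_nonpos hspos hs.2 (neg_nonpos.2 ha.le)
      nlinarith

lemma ESAhyp.Ib_le (hesa : ESAhyp a (dt T n) T ε h Nlo Nhi) (hT : 0 < T) (hn : 0 < n)
    (ha : 0 < a) (hε : 0 < ε) {k l : ℕ} (hlk : l + 2 ≤ k) (hkn : k ≤ n) :
    Ib T n a h Nlo Nhi k (l + 1) ≤ (1 + ε) * (dt T n / T) ^ (-a) * dt T n := by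
  have hle := tk_mono hT.le n (Nat.le_succ l)
  rw [Ib_eq_integral]
  calc _ ≤ ∫ _ in (tk T n l)..(tk T n (l + 1)), (1 + ε) * (dt T n / T) ^ (-a) := by
        refine intervalIntegral.integral_mono_on hle
          (Continuous.intervalIntegrable (by fun_prop) _ _)
          (Continuous.intervalIntegrable (by fun_prop) _ _) fun τ hτ => ?_
        have hs := scaled_lag_mem_Icc hT hn hlk hkn hτ
        have h1 := (abs_le.1 (hesa _ hs)).1
        have h2 := Real.rpow_le_rpow_of_nonpos (div_pos (dt_pos hT hn) hT) hs.1
          (neg_nonpos.2 ha.le)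
        nlinarith
    _ = _ := by rw [intervalIntegral.integral_const, smul_eq_mul, tk_succ]; ring

/-- A lower bound for the coefficient `b_0^k`, uniform in `k`. -/
lemma dt_rpow_le_bcoef_zero (hesa : ESAhyp a (dt T n) T ε h Nlo Nhi) (hT : 0 < T) (hn : 0 < n)
    (ha : 0 < a) (ha1 : a < 1) (hε : ε ∈ Set.Ioo (0 : ℝ) 1) {k : ℕ} (hk : 1 ≤ k) (hkn : k ≤ n) :
    (1 - ε) * (1 - a) * dt T n ^ a ≤ T ^ a * bcoef T n a h Nlo Nhi k 0 := by
  have hd := dt_pos hT hn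
  have hdT : dt T n ^ a ≤ T ^ a := by
    refine Real.rpow_le_rpow hd.le ?_ ha.le
    exact div_le_self hT.le (by exact_mod_cast hn)
  have hda := Real.rpow_pos_of_pos hd a
  rcases hk.eq_or_lt with rfl | hk2
  · have : (1 - ε) * (1 - a) ≤ 1 := by nlinarith [hε.1, hε.2]
    simp only [bcoef, if_true]
    nlinarith
  · have hI := hesa.le_Ib hT hn ha hε.2 (l := 0) hk2 hkn
    simp only [bcoef, if_true, if_neg hk2.ne']
    rw [zero_add] at hI
    have hpow : dt T n ^ (a - 1) * dt T n = dt T n ^ a := by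
      rw [← Real.rpow_add_one hd.ne']; simp
    have hTT : T ^ a * T ^ (-a) = 1 := by rw [← Real.rpow_add hT]; simp
    calc (1 - ε) * (1 - a) * dt T n ^ a
        = (T ^ a * T ^ (-a)) * (dt T n ^ (a - 1) * (1 - a)) * ((1 - ε) * dt T n) := by
          rw [hTT, ← hpow]; ring
      _ ≤ (T ^ a * T ^ (-a)) * (dt T n ^ (a - 1) * (1 - a)) * Ib T n a h Nlo Nhi k 1 := by
          refine mul_le_mul_of_nonneg_left hI ?_
          rw [hTT, one_mul]
          exact mul_nonneg (Real.rpow_nonneg hd.le _) (by linarith)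
      _ = _ := by ring

lemma bcoef_zero_nonneg (hesa : ESAhyp a (dt T n) T ε h Nlo Nhi) (hT : 0 < T) (hn : 0 < n)
    (ha : 0 < a) (ha1 : a < 1) (hε : ε ∈ Set.Ioo (0 : ℝ) 1) {k : ℕ} (hk : 1 ≤ k) (hkn : k ≤ n) :
    0 ≤ bcoef T n a h Nlo Nhi k 0 := by
  have h1 := dt_rpow_le_bcoef_zero hesa hT hn ha ha1 hε hk hkn
  have h2 : 0 ≤ (1 - ε) * (1 - a) * dt T n ^ a :=
    mul_nonneg (mul_nonneg (by linarith [hε.2]) (by linarith))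
      (Real.rpow_nonneg (dt_pos hT hn).le _)
  exact nonneg_of_mul_nonneg_right (h2.trans h1) (Real.rpow_pos_of_pos hT a)

/-- The coefficients sum to one, and only `b_{k-1}^k` may be negative, by at most `ε`. -/
lemma sum_abs_bcoef_le (hesa : ESAhyp a (dt T n) T ε h Nlo Nhi) (hT : 0 < T) (hn : 0 < n)
    (ha : 0 < a) (ha1 : a < 1) (hh : 0 < h) (hε : ε ∈ Set.Ioo (0 : ℝ) 1)
    {k : ℕ} (hk : 1 ≤ k) (hkn : k ≤ n) :
    ∑ l ∈ Finset.Icc 1 (k - 1), |bcoef T n a h Nlo Nhi k l| + bcoef T n a h Nlo Nhi k 0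
      ≤ 1 + 2 * ε := by
  rcases hk.eq_or_lt with rfl | hk2
  · simp [bcoef, hε.1.le]
  obtain ⟨q, rfl⟩ := Nat.exists_eq_add_of_le' hk2
  have hd := dt_pos hT hn
  set C := T ^ (-a) * dt T n ^ (a - 1) * (1 - a) with hC
  have hC0 : 0 ≤ C := mul_nonneg (mul_nonneg (Real.rpow_nonneg hT.le _)
    (Real.rpow_nonneg hd.le _)) (by linarith)
  have hmid : ∑ l ∈ Finset.Icc 1 q, |bcoef T n a h Nlo Nhi (q + 2) l|
      = C * (Ib T n a h Nlo Nhi (q + 2) (q + 1) - Ib T n a h Nlo Nhi (q + 2) 1) := by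
    have : ∀ l ∈ Finset.Icc 1 q, |bcoef T n a h Nlo Nhi (q + 2) l|
        = C * (Ib T n a h Nlo Nhi (q + 2) (l + 1) - Ib T n a h Nlo Nhi (q + 2) l) := by
      intro l hl
      obtain ⟨hl1, hlq⟩ := Finset.mem_Icc.1 hl
      obtain ⟨p, rfl⟩ := Nat.exists_eq_add_of_le' hl1
      rw [bcoef, if_neg (by omega), if_neg (by omega), if_neg (by omega)]
      exact abs_of_nonneg (mul_nonneg hC0
        (sub_nonneg.2 (Ib_le_Ib_succ hT n ha hh Nlo Nhi (q + 2) p)))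
    rw [Finset.sum_congr rfl this, ← Finset.mul_sum, ← Finset.Ico_add_one_right_eq_Icc,
      Finset.sum_Ico_sub _ (by omega)]
  have hlast : C * Ib T n a h Nlo Nhi (q + 2) (q + 1) ≤ 1 + ε := by
    have hpow : dt T n ^ (a - 1) * dt T n = dt T n ^ a := by
      rw [← Real.rpow_add_one hd.ne']; simp
    have hdd : dt T n ^ a * dt T n ^ (-a) = 1 := by rw [← Real.rpow_add hd]; simp
    have hTT : T ^ (-a) ≠ 0 := (Real.rpow_pos_of_pos hT _).ne'
    calc C * Ib T n a h Nlo Nhi (q + 2) (q + 1)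
        ≤ C * ((1 + ε) * (dt T n / T) ^ (-a) * dt T n) :=
          mul_le_mul_of_nonneg_left (hesa.Ib_le hT hn ha hε.1 le_rfl hkn) hC0
      _ = (1 + ε) * (1 - a) * (dt T n ^ (a - 1) * dt T n * dt T n ^ (-a)) := by
          rw [Real.div_rpow hd.le hT.le, hC]; field_simp
      _ ≤ 1 + ε := by rw [hpow, hdd]; nlinarith [hε.1]
  rw [show q + 2 - 1 = q + 1 from rfl, Finset.sum_Icc_succ_top (by omega), hmid]
  have hb0 : bcoef T n a h Nlo Nhi (q + 2) 0 = C * Ib T n a h Nlo Nhi (q + 2) 1 := by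
    simp [bcoef, hC]
  have hbl : bcoef T n a h Nlo Nhi (q + 2) (q + 1)
      = 1 - C * Ib T n a h Nlo Nhi (q + 2) (q + 1) := by
    simp [bcoef, hC]
  rw [hb0, hbl]
  rcases abs_cases (1 - C * Ib T n a h Nlo Nhi (q + 2) (q + 1)) with ⟨h1, _⟩ | ⟨h1, _⟩ <;>
    rw [h1] <;> linarith [hε.1]

end ESAbounds

/-- Discrete maximum principle for `-δ² + s` with zero boundary values. -/
lemma discrete_maximum_principle {m : ℕ} {e g : ℕ → ℝ} {s G : ℝ} (hs : 0 ≤ s)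
    (he : ∀ j ∈ Finset.Icc 1 (m - 1), -e (j + 1) + (2 + s) * e j - e (j - 1) = g j)
    (h0 : e 0 = 0) (hm : e m = 0) (hg : ∀ j ∈ Finset.Icc 1 (m - 1), |g j| ≤ G) :
    ∀ j ∈ Finset.Icc 1 (m - 1), s * |e j| ≤ G := by
  intro j hj
  obtain ⟨p, hp, hmax⟩ := Finset.exists_max_image (Finset.Icc 1 (m - 1)) (fun j => |e j|) ⟨j, hj⟩
  have hall : ∀ i ≤ m, |e i| ≤ |e p| := by
    intro i hi
    by_cases hi' : i ∈ Finset.Icc 1 (m - 1)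
    · exact hmax i hi'
    · have : i = 0 ∨ i = m := by rw [Finset.mem_Icc] at hi'; omega
      rcases this with rfl | rfl <;> simp [h0, hm]
  have hp' := Finset.mem_Icc.1 hp
  have h1 := hall (p + 1) (by omega)
  have h2 := hall (p - 1) (by omega)
  have h3 : (2 + s) * |e p| ≤ |e (p + 1)| + |e (p - 1)| + |g p| := by
    rw [← abs_of_nonneg (show 0 ≤ 2 + s by linarith), ← abs_mul,
      show (2 + s) * e p = e (p + 1) + e (p - 1) + g p by linarith [he p hp]]
    exact abs_add_three _ _ _
  have h4 := hg p hp
  have h5 := mul_le_mul_of_nonneg_left (hmax j hj) hs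
  linarith

/-- The scaled residual `Δx² R` is absorbed by the coefficient `b_0^k`. -/
lemma sq_mul_le_skcoef_mul {T : ℝ} {n : ℕ} {a A ε h : ℝ} {Nlo Nhi : ℤ}
    (hesa : ESAhyp a (dt T n) T ε h Nlo Nhi) (hT : 1 ≤ T) (hn : 0 < n)
    (ha : 0 < a) (haA : a ≤ A) (ha1 : a < 1) (hε : ε ∈ Set.Ioo (0 : ℝ) 1)
    {k : ℕ} (hk : 1 ≤ k) (hkn : k ≤ n) {R c : ℝ} (hR : 0 ≤ R) (hc : Real.Gamma (1 - a) ≤ c)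
    (Dx : ℝ) :
    Dx ^ 2 * R ≤ skcoef T n a Dx * (bcoef T n a h Nlo Nhi k 0 * (R * c / (1 - ε) * T ^ A)) := by
  have hT0 : 0 < T := by linarith
  have hd := dt_pos hT0 hn
  have hda := Real.rpow_pos_of_pos hd a
  have hε1 : 0 < 1 - ε := by linarith [hε.2]
  have ha1' : 0 < 1 - a := by linarith
  have hG := Real.Gamma_pos_of_pos ha1'
  have hΓ : Real.Gamma (2 - a) = (1 - a) * Real.Gamma (1 - a) := by
    rw [← Real.Gamma_add_one ha1'.ne']; ring_nf
  have hb := bcoef_zero_nonneg hesa hT0 hn ha ha1 hε hk hkn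
  have key : (1 - ε) * (dt T n ^ a * Real.Gamma (2 - a))
      ≤ bcoef T n a h Nlo Nhi k 0 * (c * T ^ A) := by
    calc (1 - ε) * (dt T n ^ a * Real.Gamma (2 - a))
        = ((1 - ε) * (1 - a) * dt T n ^ a) * Real.Gamma (1 - a) := by rw [hΓ]; ring
      _ ≤ (T ^ a * bcoef T n a h Nlo Nhi k 0) * Real.Gamma (1 - a) :=
          mul_le_mul_of_nonneg_right
            (dt_rpow_le_bcoef_zero hesa hT0 hn ha ha1 hε hk hkn) hG.le
      _ = bcoef T n a h Nlo Nhi k 0 * (Real.Gamma (1 - a) * T ^ a) := by ring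
      _ ≤ _ := by
          refine mul_le_mul_of_nonneg_left (mul_le_mul hc
            (Real.rpow_le_rpow_of_exponent_le hT haA) (Real.rpow_nonneg hT0.le _)
            (hG.le.trans hc)) hb
  have hG2 : 0 < Real.Gamma (2 - a) := by rw [hΓ]; positivity
  rw [skcoef, Real.rpow_neg hd.le]
  calc Dx ^ 2 * R = Dx ^ 2 * R * (((1 - ε) * (dt T n ^ a * Real.Gamma (2 - a))) /
        ((1 - ε) * (dt T n ^ a * Real.Gamma (2 - a)))) := by
        rw [div_self (by positivity), mul_one]
    _ ≤ Dx ^ 2 * R * ((bcoef T n a h Nlo Nhi k 0 * (c * T ^ A)) /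
        ((1 - ε) * (dt T n ^ a * Real.Gamma (2 - a)))) := by gcongr
    _ = _ := by field_simp

/-- The error-equation estimate: under the ESA hypothesis at every time level, any solution of
the error equation with zero initial and boundary data satisfies
max_j |E_j^k| ≤ c_r c_γ (1+2ε)^k/(1−ε) T^ᾱ. -/
theorem fast_esa_error_equation_bound
    (T : ℝ) (hT : 1 ≤ T) (n : ℕ) (hn : 0 < n)
    (alo ahi : ℝ) (halo : 0 < alo) (hlh : alo ≤ ahi) (hahi : ahi < 1)
    (αf : ℝ → ℝ) (hα : ∀ s ∈ Set.Icc (0:ℝ) T, αf s ∈ Set.Icc alo ahi)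
    (h : ℝ) (hh : 0 < h) (Nlo Nhi : ℤ) (hN : Nlo < Nhi)
    (ε : ℝ) (hε : ε ∈ Set.Ioo (0:ℝ) 1)
    (hesa : ∀ k ∈ Finset.Icc 1 n, ESAhyp (αf (tk T n k)) (dt T n) T ε h Nlo Nhi)
    (xR : ℝ) (hxR : 0 < xR) (m : ℕ) (hm : 2 ≤ m)
    (E r : ℕ → ℕ → ℝ)
    (hscheme : ∀ k ∈ Finset.Icc 1 n, ∀ j ∈ Finset.Icc 1 (m-1),
      -E k (j+1) + (2 + skcoef T n (αf (tk T n k)) (xR / m)) * E k j - E k (j-1)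
        = skcoef T n (αf (tk T n k)) (xR / m) *
              (∑ l ∈ Finset.Icc 1 (k-1), bcoef T n (αf (tk T n k)) h Nlo Nhi k l * E l j)
          + skcoef T n (αf (tk T n k)) (xR / m) *
              bcoef T n (αf (tk T n k)) h Nlo Nhi k 0 * E 0 j
          + (xR / m) ^ 2 * r k j)
    (hE0 : ∀ j ∈ Finset.Icc 1 (m-1), E 0 j = 0)
    (hbc : ∀ k ∈ Finset.Icc 1 n, E k 0 = 0 ∧ E k m = 0) :
    ∀ k ∈ Finset.Icc 1 n, ∀ j ∈ Finset.Icc 1 (m-1),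
      |E k j| ≤
        ((Finset.Icc 1 n).sup' (Finset.nonempty_Icc.2 (by omega)) fun k =>
            (Finset.Icc 1 (m-1)).sup' (Finset.nonempty_Icc.2 (by omega)) fun j => |r k j|)
          * ((Finset.Icc 1 n).sup' (Finset.nonempty_Icc.2 (by omega)) fun k =>
              Real.Gamma (1 - αf (tk T n k)))
          * ((1 + 2 * ε) ^ k / (1 - ε)) * T ^ ahi := by
  set cr := (Finset.Icc 1 n).sup' (Finset.nonempty_Icc.2 (by omega)) fun k =>
    (Finset.Icc 1 (m-1)).sup' (Finset.nonempty_Icc.2 (by omega)) fun j => |r k j| with hcr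
  set cγ := (Finset.Icc 1 n).sup' (Finset.nonempty_Icc.2 (by omega)) fun k =>
    Real.Gamma (1 - αf (tk T n k)) with hcγ
  have hT0 : 0 < T := by linarith
  have hε1 : 0 < 1 - ε := by linarith [hε.2]
  have hr : ∀ k ∈ Finset.Icc 1 n, ∀ j ∈ Finset.Icc 1 (m - 1), |r k j| ≤ cr := by
    intro k hk j hj
    refine le_trans ?_ (Finset.le_sup' (fun k =>
      (Finset.Icc 1 (m-1)).sup' (Finset.nonempty_Icc.2 (by omega)) fun j => |r k j|) hk)
    exact Finset.le_sup' (fun j => |r k j|) hj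
  have hγ : ∀ k ∈ Finset.Icc 1 n, Real.Gamma (1 - αf (tk T n k)) ≤ cγ := fun k hk =>
    Finset.le_sup' (fun k => Real.Gamma (1 - αf (tk T n k))) hk
  have hmemα : ∀ k ∈ Finset.Icc 1 n, αf (tk T n k) ∈ Set.Icc alo ahi := by
    intro k hk
    refine hα _ ⟨tk_nonneg hT0.le n k, ?_⟩
    calc tk T n k ≤ tk T n n := tk_mono hT0.le n (Finset.mem_Icc.1 hk).2
      _ = T := tk_self T hn
  have hcr0 : 0 ≤ cr := (abs_nonneg _).trans
    (hr 1 (Finset.mem_Icc.2 ⟨le_rfl, hn⟩) 1 (Finset.mem_Icc.2 ⟨le_rfl, by omega⟩))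
  have hcγ0 : 0 ≤ cγ := by
    have h1 : 1 ∈ Finset.Icc 1 n := Finset.mem_Icc.2 ⟨le_rfl, hn⟩
    exact (Real.Gamma_pos_of_pos (by linarith [(hmemα 1 h1).2])).le.trans (hγ 1 h1)
  set M := cr * cγ / (1 - ε) * T ^ ahi with hM
  have hM0 : 0 ≤ M := by positivity
  suffices hmain : ∀ k ∈ Finset.Icc 1 n, ∀ j ∈ Finset.Icc 1 (m - 1),
      |E k j| ≤ (1 + 2 * ε) ^ k * M by
    intro k hk j hj
    refine (hmain k hk j hj).trans_eq ?_
    rw [hM]; ring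
  intro k
  induction k using Nat.strong_induction_on with
  | _ k ih =>
  intro hk
  obtain ⟨hk1, hkn⟩ := Finset.mem_Icc.1 hk
  obtain ⟨hlo, hhi⟩ := hmemα k hk
  have hesak := hesa k hk
  have hγk := hγ k hk
  have hsch := hscheme k hk
  set a := αf (tk T n k)
  have ha : 0 < a := by linarith
  have ha1 : a < 1 := by linarith
  have hx : 0 < xR / m := div_pos hxR (by exact_mod_cast (by omega : 0 < m))
  have hs : 0 < skcoef T n a (xR / m) :=
    div_pos (mul_pos (pow_pos hx 2) (Real.rpow_pos_of_pos (dt_pos hT0 hn) _))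
      (Real.Gamma_pos_of_pos (by linarith))
  have hb0 := bcoef_zero_nonneg hesak hT0 hn ha ha1 hε hk1 hkn
  have hsum := sum_abs_bcoef_le hesak hT0 hn ha ha1 hh hε hk1 hkn
  have hres := sq_mul_le_skcoef_mul hesak hT hn ha hhi ha1 hε hk1 hkn hcr0 hγk (xR / m)
  have hq : 1 ≤ 1 + 2 * ε := by linarith [hε.1]
  set b := bcoef T n a h Nlo Nhi k
  have hhist : ∀ j ∈ Finset.Icc 1 (m - 1), |∑ l ∈ Finset.Icc 1 (k - 1), b l * E l j|
      ≤ (∑ l ∈ Finset.Icc 1 (k - 1), |b l|) * ((1 + 2 * ε) ^ (k - 1) * M) := by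
    intro j hj
    rw [Finset.sum_mul]
    refine (Finset.abs_sum_le_sum_abs _ _).trans (Finset.sum_le_sum fun l hl => ?_)
    obtain ⟨hl1, hlk⟩ := Finset.mem_Icc.1 hl
    rw [abs_mul]
    refine mul_le_mul_of_nonneg_left ?_ (abs_nonneg _)
    refine (ih l (by omega) (Finset.mem_Icc.2 ⟨hl1, by omega⟩) j hj).trans ?_
    exact mul_le_mul_of_nonneg_right (pow_le_pow_right₀ hq hlk) hM0
  have hbound : (∑ l ∈ Finset.Icc 1 (k - 1), |b l|) * ((1 + 2 * ε) ^ (k - 1) * M) + b 0 * M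
      ≤ (1 + 2 * ε) ^ k * M := by
    have h1 : M ≤ (1 + 2 * ε) ^ (k - 1) * M := le_mul_of_one_le_left hM0 (one_le_pow₀ hq)
    calc _ ≤ (∑ l ∈ Finset.Icc 1 (k - 1), |b l|) * ((1 + 2 * ε) ^ (k - 1) * M)
          + b 0 * ((1 + 2 * ε) ^ (k - 1) * M) := by gcongr
      _ = (∑ l ∈ Finset.Icc 1 (k - 1), |b l| + b 0) * ((1 + 2 * ε) ^ (k - 1) * M) := by ring
      _ ≤ (1 + 2 * ε) * ((1 + 2 * ε) ^ (k - 1) * M) := by gcongr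
      _ = (1 + 2 * ε) ^ k * M := by
        rw [← mul_assoc, ← pow_succ', Nat.sub_add_cancel hk1]
  intro j hj
  refine le_of_mul_le_mul_left ?_ hs
  refine discrete_maximum_principle hs.le hsch (hbc k hk).1 (hbc k hk).2 (fun i hi => ?_) j hj
  rw [hE0 i hi, mul_zero, add_zero]
  have h1 : |(xR / m) ^ 2 * r k i| ≤ (xR / m) ^ 2 * cr := by
    rw [abs_mul, abs_of_nonneg (sq_nonneg _)]
    exact mul_le_mul_of_nonneg_left (hr k hk i hi) (sq_nonneg _)
  calc _ ≤ skcoef T n a (xR / m) * |∑ l ∈ Finset.Icc 1 (k - 1), b l * E l i|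
        + |(xR / m) ^ 2 * r k i| := by
        refine (abs_add_le _ _).trans_eq ?_
        rw [abs_mul, abs_of_pos hs]
    _ ≤ skcoef T n a (xR / m) * ((∑ l ∈ Finset.Icc 1 (k - 1), |b l|) *
          ((1 + 2 * ε) ^ (k - 1) * M)) + skcoef T n a (xR / m) * (b 0 * M) :=
        add_le_add (mul_le_mul_of_nonneg_left (hhist i hi) hs.le) (h1.trans hres)
    _ ≤ _ := by
        rw [← mul_add]
        exact mul_le_mul_of_nonneg_left hbound hs.le
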